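/- arXiv:2003.09801 — 4 statements merged into one kernel-verified Lean document; each statement's English description precedes it below -/
import Mathlib

section
/- In the hyperbolic linear cocycle setting with bounded inhomogeneity (X_k), assume additionally C_P := sup_{k∈ℤ} max(‖P⁺_k‖_op, ‖P⁻_k‖_op) < ∞. Then for every k ∈ ℤ both series defining the shadowing direction v_k := Σ_{n≥0} Φ_{k−n}^{(n)} P⁻_{k−n} X_{k−n} − Σ_{n≥1} Φ_{k+n}^{(−n)} P⁺_{k+n} X_{k+n} converge absolutely; the resulting sequence (v_k)_{k∈ℤ} is an inhomogeneous tangent solution, i.e. v_{k+1} = A_k v_k + X_{k+1} for all k ∈ ℤ; and it is uniformly bounded with sup_{k∈ℤ} ‖v_k‖ ≤ 2 C₁ C_P χ / (1−λ). -/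
open scoped InnerProductSpace

/-- The cocycle `Φ_k^{(n)} := A_{k+n−1} ∘ ⋯ ∘ A_k`, with `Φ_k^{(0)} = id`;
`Φ_k^{(−n)}` is realized as `(Phi A (k−n) n).symm`. -/
noncomputable def Phi {M : ℕ}
    (A : ℤ → EuclideanSpace ℝ (Fin M) ≃L[ℝ] EuclideanSpace ℝ (Fin M)) :
    ℤ → ℕ → (EuclideanSpace ℝ (Fin M) ≃L[ℝ] EuclideanSpace ℝ (Fin M))
  | _, 0 => ContinuousLinearEquiv.refl ℝ _
  | k, (n + 1) => (Phi A k n).trans (A (k + n))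

section Cocycle

variable {M : ℕ} (A : ℤ → EuclideanSpace ℝ (Fin M) ≃L[ℝ] EuclideanSpace ℝ (Fin M))

theorem Phi_succ_apply (k : ℤ) (n : ℕ) (x : EuclideanSpace ℝ (Fin M)) :
    Phi A k (n + 1) x = A (k + n) (Phi A k n x) := rfl

theorem Phi_succ_apply' (k : ℤ) (n : ℕ) (x : EuclideanSpace ℝ (Fin M)) :
    Phi A k (n + 1) x = Phi A (k + 1) n (A k x) := by
  induction n with
  | zero => simp [Phi]
  | succ n ih =>
    rw [Phi_succ_apply, ih, Phi_succ_apply]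
    congr 2
    push_cast
    ring

theorem apply_Phi_succ_symm (k : ℤ) (n : ℕ) (y : EuclideanSpace ℝ (Fin M)) :
    A k ((Phi A k (n + 1)).symm y) = (Phi A (k + 1) n).symm y := by
  rw [ContinuousLinearEquiv.eq_symm_apply, ← Phi_succ_apply',
    ContinuousLinearEquiv.apply_symm_apply]

end Cocycle

/-- In the hyperbolic linear cocycle setting with bounded inhomogeneity
and uniformly bounded projections (`C_P`), the two series defining the shadowing
direction `v_k = Σ_{n≥0} Φ_{k−n}^{(n)} P⁻_{k−n} X_{k−n} − Σ_{n≥1} Φ_{k+n}^{(−n)} P⁺_{k+n} X_{k+n}`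
converge absolutely, `v` is an inhomogeneous tangent solution
(`v_{k+1} = A_k v_k + X_{k+1}`), and `sup_k ‖v_k‖ ≤ 2 C₁ C_P χ / (1−λ)`. -/
theorem stmt0 (M : ℕ) (hM : 0 < M)
    (A : ℤ → EuclideanSpace ℝ (Fin M) ≃L[ℝ] EuclideanSpace ℝ (Fin M))
    (Pp Pm : ℤ → EuclideanSpace ℝ (Fin M) →L[ℝ] EuclideanSpace ℝ (Fin M))
    (hPp : ∀ k x, Pp k (Pp k x) = Pp k x)
    (hPm : ∀ k x, Pm k (Pm k x) = Pm k x)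
    (hsum : ∀ k x, Pp k x + Pm k x = x)
    (hequiv : ∀ k x, A k (Pp k x) = Pp (k + 1) (A k x))
    (C₁ lam : ℝ) (hC₁ : 1 ≤ C₁) (hlam0 : 0 < lam) (hlam1 : lam < 1)
    (hstab : ∀ (k : ℤ) (n : ℕ) (x), ‖Phi A k n (Pm k x)‖ ≤ C₁ * lam ^ n * ‖x‖)
    (hunstab : ∀ (k : ℤ) (n : ℕ) (x), ‖(Phi A (k - n) n).symm (Pp k x)‖ ≤ C₁ * lam ^ n * ‖x‖)
    (X : ℤ → EuclideanSpace ℝ (Fin M)) (χ : ℝ) (hχ : ∀ k, ‖X k‖ ≤ χ)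
    (CP : ℝ)
    (hCPp : ∀ k x, ‖Pp k x‖ ≤ CP * ‖x‖) (hCPm : ∀ k x, ‖Pm k x‖ ≤ CP * ‖x‖) :
    (∀ k : ℤ,
        Summable (fun n : ℕ => ‖Phi A (k - n) n (Pm (k - n) (X (k - n)))‖)
        ∧ Summable (fun n : ℕ => ‖(Phi A k (n + 1)).symm (Pp (k + n + 1) (X (k + n + 1)))‖))
    ∧ (∀ k : ℤ,
        ((∑' n : ℕ, Phi A ((k + 1) - n) n (Pm ((k + 1) - n) (X ((k + 1) - n))))
            - ∑' n : ℕ, (Phi A (k + 1) (n + 1)).symm (Pp ((k + 1) + n + 1) (X ((k + 1) + n + 1))))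
          = A k ((∑' n : ℕ, Phi A (k - n) n (Pm (k - n) (X (k - n))))
              - ∑' n : ℕ, (Phi A k (n + 1)).symm (Pp (k + n + 1) (X (k + n + 1))))
            + X (k + 1))
    ∧ (∀ k : ℤ,
        ‖(∑' n : ℕ, Phi A (k - n) n (Pm (k - n) (X (k - n))))
            - ∑' n : ℕ, (Phi A k (n + 1)).symm (Pp (k + n + 1) (X (k + n + 1)))‖
          ≤ 2 * C₁ * CP * χ / (1 - lam)) := by
  have hCP : 0 ≤ CP := by
    have := (norm_nonneg _).trans (hCPp 0 (EuclideanSpace.single ⟨0, hM⟩ 1))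
    simpa using this
  have hC : 0 ≤ C₁ := zero_le_one.trans hC₁
  have hχ0 : 0 ≤ χ := (norm_nonneg _).trans (hχ 0)
  have hs : ∀ (k : ℤ) (n : ℕ),
      ‖Phi A (k - n) n (Pm (k - n) (X (k - n)))‖ ≤ C₁ * CP * χ * lam ^ n := fun k n ↦
    calc _ = ‖Phi A (k - n) n (Pm (k - n) (Pm (k - n) (X (k - n))))‖ := by rw [hPm]
      _ ≤ C₁ * lam ^ n * ‖Pm (k - n) (X (k - n))‖ := hstab _ _ _
      _ ≤ C₁ * lam ^ n * (CP * χ) := by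
        gcongr
        exact (hCPm _ _).trans (by gcongr; exact hχ _)
      _ = _ := by ring
  have hu : ∀ (k : ℤ) (n : ℕ),
      ‖(Phi A k (n + 1)).symm (Pp (k + n + 1) (X (k + n + 1)))‖
        ≤ C₁ * CP * χ * lam ^ n := fun k n ↦ by
    have h := hunstab (k + n + 1) (n + 1) (Pp (k + n + 1) (X (k + n + 1)))
    rw [hPp, show k + n + 1 - ((n + 1 : ℕ) : ℤ) = k by push_cast; ring] at h
    calc _ ≤ C₁ * lam ^ (n + 1) * ‖Pp (k + n + 1) (X (k + n + 1))‖ := h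
      _ ≤ C₁ * lam ^ n * (CP * χ) := by
        gcongr ?_ * ?_
        · exact mul_le_mul_of_nonneg_left
            (pow_le_pow_of_le_one hlam0.le hlam1.le n.le_succ) hC
        · exact (hCPp _ _).trans (by gcongr; exact hχ _)
      _ = _ := by ring
  have hgeom : HasSum (fun n : ℕ ↦ C₁ * CP * χ * lam ^ n) (C₁ * CP * χ * (1 - lam)⁻¹) :=
    (hasSum_geometric_of_lt_one hlam0.le hlam1).mul_left _
  have hsS := fun k ↦ Summable.of_nonneg_of_le (fun _ ↦ norm_nonneg _) (hs k) hgeom.summable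
  have huS := fun k ↦ Summable.of_nonneg_of_le (fun _ ↦ norm_nonneg _) (hu k) hgeom.summable
  refine ⟨fun k ↦ ⟨hsS k, huS k⟩, fun k ↦ ?_, fun k ↦ ?_⟩
  · have hstable : ∑' n : ℕ, Phi A ((k + 1) - n) n (Pm ((k + 1) - n) (X ((k + 1) - n)))
        = Pm (k + 1) (X (k + 1))
          + A k (∑' n : ℕ, Phi A (k - n) n (Pm (k - n) (X (k - n)))) := by
      rw [(hsS (k + 1)).of_norm.tsum_eq_zero_add, (A k).map_tsum]
      congr 1
      · simp [Phi]
      · refine tsum_congr fun n ↦ ?_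
        rw [show k + 1 - ((n + 1 : ℕ) : ℤ) = k - n by push_cast; ring, Phi_succ_apply,
          sub_add_cancel]
    have hunstable : A k (∑' n : ℕ, (Phi A k (n + 1)).symm (Pp (k + n + 1) (X (k + n + 1))))
        = Pp (k + 1) (X (k + 1)) + ∑' n : ℕ,
          (Phi A (k + 1) (n + 1)).symm (Pp ((k + 1) + n + 1) (X ((k + 1) + n + 1))) := by
      have hS := (A k).summable.2 (huS k).of_norm
      rw [(A k).map_tsum, hS.tsum_eq_zero_add]
      simp only [apply_Phi_succ_symm]
      congr 1
      · simp [Phi]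
      · refine tsum_congr fun n ↦ ?_
        rw [show k + ((n + 1 : ℕ) : ℤ) + 1 = k + 1 + n + 1 by push_cast; ring]
    rw [map_sub, hstable, hunstable, eq_sub_of_add_eq' (hsum (k + 1) (X (k + 1)))]
    abel
  · calc _ ≤ _ := norm_sub_le _ _
      _ ≤ C₁ * CP * χ * (1 - lam)⁻¹ + C₁ * CP * χ * (1 - lam)⁻¹ :=
        add_le_add (tsum_of_norm_bounded hgeom (hs k)) (tsum_of_norm_bounded hgeom (hu k))
      _ = _ := by ring
end

section
/- (Shadowing computes the shadowing contribution.) In the hyperbolic diffeomorphism setting, both series Σ_{n≥0} ∫ ⟨∇(J∘fⁿ)(u), P⁻(u)X(u)⟩ dρ(u) and Σ_{n≥1} ∫ ⟨∇(J∘f^{−n})(u), P⁺(u)X(u)⟩ dρ(u) converge absolutely, the series defining the shadowing direction field v(u) := Σ_{n≥0} Dfⁿ(f^{−n}u) P⁻(f^{−n}u) X(f^{−n}u) − Σ_{n≥1} Df^{−n}(fⁿu) P⁺(fⁿu) X(fⁿu) converges absolutely and uniformly on Λ, and for ρ-almost every u₀ the limit lim_{K→∞} (1/K) Σ_{k=0}^{K−1}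 ⟨∇J(f^k(u₀)), v(f^k(u₀))⟩ exists and equals Σ_{n≥0} ∫ ⟨∇(J∘fⁿ), P⁻X⟩ dρ − Σ_{n≥1} ∫ ⟨∇(J∘f^{−n}), P⁺X⟩ dρ. -/
open MeasureTheory Filter
open scoped InnerProductSpace

/-- `n`-th term `Dfⁿ(f^{−n}u) P⁻(f^{−n}u) X(f^{−n}u)` of the stable part of the
shadowing direction field. -/
noncomputable def term1 {M : ℕ} (f finv : EuclideanSpace ℝ (Fin M) → EuclideanSpace ℝ (Fin M))
    (Pm : EuclideanSpace ℝ (Fin M) → EuclideanSpace ℝ (Fin M) →L[ℝ] EuclideanSpace ℝ (Fin M))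
    (X : EuclideanSpace ℝ (Fin M) → EuclideanSpace ℝ (Fin M)) (n : ℕ)
    (u : EuclideanSpace ℝ (Fin M)) : EuclideanSpace ℝ (Fin M) :=
  fderiv ℝ (f^[n]) (finv^[n] u) (Pm (finv^[n] u) (X (finv^[n] u)))

/-- `n`-th term `Df^{−n}(fⁿu) P⁺(fⁿu) X(fⁿu)` (for `n ≥ 1`, here indexed by `n+1`)
of the unstable part of the shadowing direction field. -/
noncomputable def term2 {M : ℕ} (f finv : EuclideanSpace ℝ (Fin M) → EuclideanSpace ℝ (Fin M))
    (Pp : EuclideanSpace ℝ (Fin M) → EuclideanSpace ℝ (Fin M) →L[ℝ] EuclideanSpace ℝ (Fin M))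
    (X : EuclideanSpace ℝ (Fin M) → EuclideanSpace ℝ (Fin M)) (n : ℕ)
    (u : EuclideanSpace ℝ (Fin M)) : EuclideanSpace ℝ (Fin M) :=
  fderiv ℝ (finv^[n + 1]) (f^[n + 1] u) (Pp (f^[n + 1] u) (X (f^[n + 1] u)))

/-- The running maximum of the Birkhoff sums of `φ`, with the empty sum included. -/
noncomputable def birkhoffMax {α : Type*} (T : α → α) (φ : α → ℝ) : ℕ → α → ℝ
  | 0, _ => 0
  | n + 1, x => max 0 (φ x + birkhoffMax T φ n (T x))

theorem birkhoffMax_nonneg {α : Type*} (T : α → α) (φ : α → ℝ) (n : ℕ) (x : α) :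
    0 ≤ birkhoffMax T φ n x := by
  cases n <;> simp [birkhoffMax]

theorem birkhoffMax_le_succ {α : Type*} (T : α → α) (φ : α → ℝ) (n : ℕ) (x : α) :
    birkhoffMax T φ n x ≤ birkhoffMax T φ (n + 1) x := by
  induction n generalizing x with
  | zero => simp [birkhoffMax]
  | succ n ih =>
    rw [birkhoffMax, birkhoffMax]
    exact max_le_max le_rfl (by linarith [ih (T x)])

theorem birkhoffSum_le_birkhoffMax {α : Type*} (T : α → α) (φ : α → ℝ) (n : ℕ) (x : α) :
    birkhoffSum T φ n x ≤ birkhoffMax T φ n x := by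
  induction n generalizing x with
  | zero => simp [birkhoffMax]
  | succ n ih =>
    rw [birkhoffSum_succ', birkhoffMax]
    exact le_max_of_le_right (by linarith [ih (T x)])

theorem integrable_birkhoffMax {α : Type*} [MeasurableSpace α] {T : α → α} {μ : Measure α}
    (hT : MeasurePreserving T μ μ) {φ : α → ℝ} (hφ : Integrable φ μ) (n : ℕ) :
    Integrable (birkhoffMax T φ n) μ := by
  induction n with
  | zero => exact integrable_zero _ _ _
  | succ n ih =>
    exact (integrable_zero _ _ _).sup (hφ.add (hT.integrable_comp_of_integrable ih))

theorem aemeasurable_birkhoffSum {α : Type*} [MeasurableSpace α] {T : α → α} {μ : Measure α}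
    (hT : MeasurePreserving T μ μ) {φ : α → ℝ} (hφ : AEMeasurable φ μ) (n : ℕ) :
    AEMeasurable (birkhoffSum T φ n) μ := by
  refine Finset.aemeasurable_fun_sum _ fun k _ ↦ ?_
  exact hφ.comp_quasiMeasurePreserving (hT.iterate k).quasiMeasurePreserving

theorem bddAbove_birkhoffSum_apply_iff {α : Type*} (T : α → α) (φ : α → ℝ) (x : α) :
    BddAbove (Set.range fun n ↦ birkhoffSum T φ n (T x)) ↔
      BddAbove (Set.range fun n ↦ birkhoffSum T φ n x) := by
  constructor
  · rintro ⟨c, hc⟩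
    refine ⟨max 0 (φ x + c), ?_⟩
    rintro _ ⟨n, rfl⟩
    cases n with
    | zero => simp
    | succ n =>
      have := hc ⟨n, rfl⟩
      simp only [birkhoffSum_succ'] at this ⊢
      exact le_max_of_le_right (by linarith)
  · rintro ⟨c, hc⟩
    refine ⟨c - φ x, ?_⟩
    rintro _ ⟨n, rfl⟩
    have := hc ⟨n + 1, rfl⟩
    simp only [birkhoffSum_succ'] at this ⊢
    linarith

theorem integral_nonneg_of_ae_not_bddAbove_birkhoffSum {α : Type*} [MeasurableSpace α]
    {T : α → α} {μ : Measure α} (hT : MeasurePreserving T μ μ) {φ : α → ℝ} (hφ : Integrable φ μ)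
    (h : ∀ᵐ x ∂μ, ¬ BddAbove (Set.range fun n ↦ birkhoffSum T φ n x)) :
    0 ≤ ∫ x, φ x ∂μ := by
  have hint := integrable_birkhoffMax hT hφ
  have hintT (n : ℕ) : Integrable (fun x ↦ birkhoffMax T φ n (T x)) μ :=
    hT.integrable_comp_of_integrable (hint n)
  have hdiff (n : ℕ) (x : α) : birkhoffMax T φ (n + 1) x - birkhoffMax T φ n (T x)
      = max (-birkhoffMax T φ n (T x)) (φ x) := by
    rw [birkhoffMax, ← max_sub_sub_right, zero_sub, add_sub_cancel_right]
  have hlim : Tendsto (fun n ↦ ∫ x, (birkhoffMax T φ (n + 1) x - birkhoffMax T φ n (T x)) ∂μ)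
      atTop (nhds (∫ x, φ x ∂μ)) := by
    refine tendsto_integral_of_dominated_convergence (fun x ↦ |φ x|)
      (fun n ↦ ((hint _).sub (hintT n)).aestronglyMeasurable) hφ.abs ?_ ?_
    · refine fun n ↦ Eventually.of_forall fun x ↦ ?_
      have := birkhoffMax_nonneg T φ n (T x)
      rw [hdiff, Real.norm_eq_abs, abs_le]
      exact ⟨le_max_of_le_right (neg_abs_le _),
        max_le (by linarith [abs_nonneg (φ x)]) (le_abs_self _)⟩
    · filter_upwards [h] with x hx
      rw [← bddAbove_birkhoffSum_apply_iff] at hx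
      have htop : Tendsto (fun n ↦ birkhoffMax T φ n (T x)) atTop atTop := by
        refine tendsto_atTop_atTop_of_monotone
          (monotone_nat_of_le_succ fun n ↦ birkhoffMax_le_succ T φ n _) fun b ↦ ?_
        obtain ⟨_, ⟨n, rfl⟩, hn⟩ := not_bddAbove_iff.1 hx b
        exact ⟨n, hn.le.trans (birkhoffSum_le_birkhoffMax T φ n _)⟩
      refine tendsto_const_nhds.congr' ?_
      filter_upwards [htop.eventually_ge_atTop (-φ x)] with n hn
      rw [hdiff, max_eq_right (by linarith)]
  refine ge_of_tendsto' hlim fun n ↦ ?_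
  rw [integral_sub (hint _) (hintT n)]
  have hinv : ∫ x, birkhoffMax T φ n (T x) ∂μ = ∫ x, birkhoffMax T φ n x ∂μ := by
    have hm := (hint n).aestronglyMeasurable
    rw [← hT.map_eq] at hm
    rw [← integral_map hT.aemeasurable hm, hT.map_eq]
  rw [hinv, sub_nonneg]
  exact integral_mono (hint n) (hint _) fun x ↦ birkhoffMax_le_succ T φ n x

theorem Ergodic.ae_bddAbove_birkhoffSum {α : Type*} [MeasurableSpace α]
    {T : α → α} {μ : Measure α} (hT : Ergodic T μ) {φ : α → ℝ} (hφ : Integrable φ μ)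
    (h : ∫ x, φ x ∂μ < 0) :
    ∀ᵐ x ∂μ, BddAbove (Set.range fun n ↦ birkhoffSum T φ n x) := by
  set A : Set α := {x | ¬ BddAbove (Set.range fun n ↦ birkhoffSum T φ n x)} with hA
  have hAm : NullMeasurableSet A μ := by
    have : A = ⋂ m : ℕ, ⋃ n : ℕ, {x | (m : ℝ) < birkhoffSum T φ n x} := by
      ext x
      simp only [hA, not_bddAbove_iff, Set.mem_ofPred_eq, Set.mem_iInter, Set.mem_iUnion,
        Set.exists_range_iff]
      refine ⟨fun H m ↦ H m, fun H b ↦ ?_⟩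
      obtain ⟨m, hm⟩ := exists_nat_ge b
      obtain ⟨n, hn⟩ := H m
      exact ⟨n, hm.trans_lt hn⟩
    rw [this]
    exact .iInter fun m ↦ .iUnion fun n ↦ nullMeasurableSet_lt aemeasurable_const
      (aemeasurable_birkhoffSum hT.toMeasurePreserving hφ.aemeasurable n)
  have hinv : T ⁻¹' A = A := by
    ext x
    exact not_congr (bddAbove_birkhoffSum_apply_iff T φ x)
  rcases hT.quasiErgodic.ae_empty_or_univ₀ hAm (.of_eq hinv) with h0 | h1
  · filter_upwards [h0] with x hx
    by_contra hx'
    exact (hx ▸ hx' : (∅ : Set α) x)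
  · refine absurd (integral_nonneg_of_ae_not_bddAbove_birkhoffSum hT.toMeasurePreserving hφ ?_)
      h.not_ge
    filter_upwards [h1] with x hx
    exact (hx ▸ trivial : A x)

theorem Ergodic.ae_eventually_birkhoffAverage_lt {α : Type*} [MeasurableSpace α]
    {T : α → α} {μ : Measure α} [IsProbabilityMeasure μ] (hT : Ergodic T μ) {φ : α → ℝ}
    (hφ : Integrable φ μ) {c : ℝ} (hc : ∫ x, φ x ∂μ < c) :
    ∀ᵐ x ∂μ, ∀ᶠ n : ℕ in atTop, birkhoffAverage ℝ T φ n x < c := by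
  obtain ⟨d, hd, hdc⟩ := exists_between hc
  have hneg : ∫ x, (φ x - d) ∂μ < 0 := by
    rw [integral_sub hφ (integrable_const d)]
    simpa using hd
  filter_upwards [hT.ae_bddAbove_birkhoffSum (hφ.sub (integrable_const d)) hneg] with x hx
  obtain ⟨b, hb⟩ := hx
  have hlim : Tendsto (fun n : ℕ ↦ b / (n : ℝ) + d) atTop (nhds (0 + d)) :=
    (tendsto_const_div_atTop_nhds_zero_nat b).add_const d
  rw [zero_add] at hlim
  filter_upwards [hlim.eventually_lt_const hdc, eventually_gt_atTop 0] with n hn hn0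
  have hn0' : (0 : ℝ) < n := by exact_mod_cast hn0
  have hbn : birkhoffSum T φ n x - n * d ≤ b := by
    simpa [birkhoffSum] using hb ⟨n, rfl⟩
  refine lt_of_le_of_lt ?_ hn
  rw [birkhoffAverage, smul_eq_mul, inv_mul_le_iff₀ hn0', mul_add, mul_div_cancel₀ _ hn0'.ne']
  linarith

/-- Birkhoff's pointwise ergodic theorem for an ergodic probability measure. -/
theorem Ergodic.ae_tendsto_birkhoffAverage {α : Type*} [MeasurableSpace α]
    {T : α → α} {μ : Measure α} [IsProbabilityMeasure μ] (hT : Ergodic T μ) {φ : α → ℝ}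
    (hφ : Integrable φ μ) :
    ∀ᵐ x ∂μ, Tendsto (fun n ↦ birkhoffAverage ℝ T φ n x) atTop (nhds (∫ x, φ x ∂μ)) := by
  have hu (k : ℕ) : ∀ᵐ x ∂μ, ∀ᶠ n : ℕ in atTop,
      birkhoffAverage ℝ T φ n x < ∫ x, φ x ∂μ + 1 / ((k : ℝ) + 1) :=
    hT.ae_eventually_birkhoffAverage_lt hφ (lt_add_of_pos_right _ Nat.one_div_pos_of_nat)
  have hl (k : ℕ) : ∀ᵐ x ∂μ, ∀ᶠ n : ℕ in atTop,
      birkhoffAverage ℝ T (-φ) n x < -∫ x, φ x ∂μ + 1 / ((k : ℝ) + 1) := by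
    refine hT.ae_eventually_birkhoffAverage_lt hφ.neg ?_
    rw [integral_neg']
    exact lt_add_of_pos_right _ Nat.one_div_pos_of_nat
  filter_upwards [ae_all_iff.2 hu, ae_all_iff.2 hl] with x hux hlx
  rw [tendsto_order]
  refine ⟨fun a ha ↦ ?_, fun a ha ↦ ?_⟩
  · obtain ⟨k, hk⟩ := exists_nat_one_div_lt (sub_pos.2 ha)
    filter_upwards [hlx k] with n hn
    have : birkhoffAverage ℝ T (-φ) n x = -birkhoffAverage ℝ T φ n x := by
      simp [birkhoffAverage, birkhoffSum]
    linarith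
  · obtain ⟨k, hk⟩ := exists_nat_one_div_lt (sub_pos.2 ha)
    filter_upwards [hux k] with n hn
    linarith

theorem measurePreserving_of_inverse {α : Type*} [MeasurableSpace α] {f g : α → α} {μ : Measure α}
    (hf : MeasurePreserving f μ μ) (hg : Measurable g) (hgf : Function.LeftInverse g f) :
    MeasurePreserving g μ μ := by
  refine ⟨hg, ?_⟩
  conv_lhs => rw [← hf.map_eq]
  rw [Measure.map_map hg hf.measurable, hgf.comp_eq_id, Measure.map_id]

section Pushforward

variable {E : Type*} [NormedAddCommGroup E] [InnerProductSpace ℝ E]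

theorem continuousOn_pushforward {a b : E → E} (ha : ContDiff ℝ 1 a) (hb : Continuous b)
    {P : E → E →L[ℝ] E} {X : E → E} (hX : Continuous X) {s : Set E} (hP : ContinuousOn P s)
    (hbs : Set.MapsTo b s s) :
    ContinuousOn (fun u ↦ fderiv ℝ a (b u) (P (b u) (X (b u)))) s :=
  ((ha.continuous_fderiv one_ne_zero).comp hb).continuousOn.clm_apply
    ((hP.comp hb.continuousOn hbs).clm_apply (hX.comp hb).continuousOn)

theorem contDiff_iterate {a : E → E} (ha : ContDiff ℝ 1 a) (n : ℕ) : ContDiff ℝ 1 a^[n] := by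
  induction n with
  | zero => exact contDiff_id
  | succ n ih => exact ih.comp ha

variable [CompleteSpace E]

theorem continuous_gradient_of_contDiff {J : E → ℝ} (hJ : ContDiff ℝ 1 J) :
    Continuous (gradient J) :=
  (InnerProductSpace.toDual ℝ E).symm.continuous.comp (hJ.continuous_fderiv one_ne_zero)

theorem inner_gradient_comp {J : E → ℝ} (hJ : ContDiff ℝ 1 J) {a : E → E}
    (ha : ContDiff ℝ 1 a) (u w : E) :
    ⟪gradient (fun x ↦ J (a x)) u, w⟫_ℝ = ⟪gradient J (a u), fderiv ℝ a u w⟫_ℝ := by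
  rw [gradient, gradient, InnerProductSpace.toDual_symm_apply,
    InnerProductSpace.toDual_symm_apply,
    fderiv_fun_comp u (hJ.differentiable one_ne_zero _) (ha.differentiable one_ne_zero _),
    ContinuousLinearMap.comp_apply]

theorem integral_inner_gradient_comp [MeasurableSpace E] [BorelSpace E] {J : E → ℝ}
    (hJ : ContDiff ℝ 1 J) {a b : E → E} (ha : ContDiff ℝ 1 a) (hb : Continuous b)
    (hba : Function.LeftInverse b a) (hab : Function.RightInverse b a) {μ : Measure E}
    (hμ : MeasurePreserving a μ μ) (Y : E → E) :
    ∫ u, ⟪gradient (fun x ↦ J (a x)) u, Y u⟫_ℝ ∂μ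
      = ∫ u, ⟪gradient J u, fderiv ℝ a (b u) (Y (b u))⟫_ℝ ∂μ := by
  have he : MeasurableEmbedding a :=
    (Homeomorph.mk ⟨a, b, hba, hab⟩ ha.continuous hb).measurableEmbedding
  rw [← hμ.integral_comp he fun u ↦ ⟪gradient J u, fderiv ℝ a (b u) (Y (b u))⟫_ℝ]
  refine integral_congr_ae (Eventually.of_forall fun u ↦ ?_)
  simp only [inner_gradient_comp hJ ha, hba u]

theorem tsum_integral_inner_of_norm_le [MeasurableSpace E] [BorelSpace E]
    [SecondCountableTopology E] {μ : Measure E} [IsFiniteMeasure μ] {s : Set E}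
    (hs : IsCompact s) (hμs : ∀ᵐ u ∂μ, u ∈ s) {g : E → E} (hg : Continuous g)
    {t : ℕ → E → E} (ht : ∀ n, ContinuousOn (t n) s) {c : ℕ → ℝ} (hc : Summable c)
    (htc : ∀ n, ∀ u ∈ s, ‖t n u‖ ≤ c n) :
    Summable (fun n ↦ |∫ u, ⟪g u, t n u⟫_ℝ ∂μ|)
    ∧ Integrable (fun u ↦ ⟪g u, ∑' n, t n u⟫_ℝ) μ
    ∧ ∑' n, ∫ u, ⟪g u, t n u⟫_ℝ ∂μ = ∫ u, ⟪g u, ∑' n, t n u⟫_ℝ ∂μ := by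
  have hrestrict : μ.restrict s = μ := Measure.restrict_eq_self_of_ae_mem hμs
  have hint {h : E → E} (hh : ContinuousOn h s) : Integrable (fun u ↦ ⟪g u, h u⟫_ℝ) μ := by
    rw [← hrestrict]
    exact (hg.continuousOn.inner hh).integrableOn_compact hs
  obtain ⟨G, hG⟩ := hs.exists_bound_of_continuousOn hg.continuousOn
  have hbound (n : ℕ) : ∫ u, ‖⟪g u, t n u⟫_ℝ‖ ∂μ ≤ G * c n * μ.real Set.univ := by
    have hle : ∀ᵐ u ∂μ, ‖⟪g u, t n u⟫_ℝ‖ ≤ G * c n := by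
      filter_upwards [hμs] with u hu
      exact (norm_inner_le_norm _ _).trans (mul_le_mul (hG u hu) (htc n u hu) (norm_nonneg _)
        ((norm_nonneg _).trans (hG u hu)))
    refine (integral_mono_ae (hint (ht n)).norm (integrable_const _) hle).trans_eq ?_
    rw [integral_const, smul_eq_mul, mul_comm]
  have hsum : Summable fun n ↦ ∫ u, ‖⟪g u, t n u⟫_ℝ‖ ∂μ :=
    .of_nonneg_of_le (fun n ↦ integral_nonneg fun u ↦ norm_nonneg _) hbound
      ((hc.mul_left G).mul_right _)
  refine ⟨.of_nonneg_of_le (fun n ↦ abs_nonneg _) (fun n ↦ abs_integral_le_integral_abs) hsum,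
    hint (continuousOn_tsum ht hc htc), ?_⟩
  rw [integral_tsum_of_summable_integral_norm (fun n ↦ hint (ht n)) hsum]
  refine integral_congr_ae ?_
  filter_upwards [hμs] with u hu
  have : Summable fun n ↦ t n u := .of_norm_bounded hc fun n ↦ htc n u hu
  exact ((innerSL ℝ (g u)).map_tsum this).symm

end Pushforward

/-- Shadowing computes the shadowing contribution. In the hyperbolic
diffeomorphism setting, the two series `Σ_{n≥0} ρ⟨∇(J∘fⁿ), P⁻X⟩` and
`Σ_{n≥1} ρ⟨∇(J∘f^{−n}), P⁺X⟩` converge absolutely, the series defining the shadowing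
direction field `v` converge absolutely and uniformly on `Λ`, and for `ρ`-a.e. `u₀`
the time average of `⟨∇J, v⟩` along the trajectory of `u₀` converges to
`Σ_{n≥0} ρ⟨∇(J∘fⁿ), P⁻X⟩ − Σ_{n≥1} ρ⟨∇(J∘f^{−n}), P⁺X⟩`. -/
theorem stmt3 (M : ℕ) (hM : 0 < M)
    (f finv : EuclideanSpace ℝ (Fin M) → EuclideanSpace ℝ (Fin M))
    (hfC : ContDiff ℝ 1 f) (hfiC : ContDiff ℝ 1 finv)
    (hleft : Function.LeftInverse finv f) (hright : Function.RightInverse finv f)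
    (ρ : Measure (EuclideanSpace ℝ (Fin M))) [IsProbabilityMeasure ρ]
    (herg : Ergodic f ρ)
    (Λ : Set (EuclideanSpace ℝ (Fin M)))
    (hΛc : IsCompact Λ) (hΛρ : ρ Λ = 1) (hΛf : f '' Λ = Λ)
    (Pp Pm : EuclideanSpace ℝ (Fin M) → EuclideanSpace ℝ (Fin M) →L[ℝ] EuclideanSpace ℝ (Fin M))
    (hPpc : ContinuousOn Pp Λ) (hPmc : ContinuousOn Pm Λ)
    (hsum : ∀ u ∈ Λ, ∀ x, Pp u x + Pm u x = x)
    (hequivp : ∀ u ∈ Λ, ∀ x, fderiv ℝ f u (Pp u x) = Pp (f u) (fderiv ℝ f u x))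
    (hequivm : ∀ u ∈ Λ, ∀ x, fderiv ℝ f u (Pm u x) = Pm (f u) (fderiv ℝ f u x))
    (C₁ lam : ℝ) (hC₁ : 1 ≤ C₁) (hlam0 : 0 < lam) (hlam1 : lam < 1)
    (hstab : ∀ u ∈ Λ, ∀ (n : ℕ) (x), ‖fderiv ℝ (f^[n]) u (Pm u x)‖ ≤ C₁ * lam ^ n * ‖x‖)
    (hunstab : ∀ u ∈ Λ, ∀ (n : ℕ) (x), ‖fderiv ℝ (finv^[n]) u (Pp u x)‖ ≤ C₁ * lam ^ n * ‖x‖)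
    (X : EuclideanSpace ℝ (Fin M) → EuclideanSpace ℝ (Fin M)) (hX : Continuous X)
    (J : EuclideanSpace ℝ (Fin M) → ℝ) (hJ : ContDiff ℝ 1 J) :
    Summable (fun n : ℕ =>
        |∫ u, ⟪gradient (fun w => J (f^[n] w)) u, Pm u (X u)⟫_ℝ ∂ρ|)
    ∧ Summable (fun n : ℕ =>
        |∫ u, ⟪gradient (fun w => J (finv^[n + 1] w)) u, Pp u (X u)⟫_ℝ ∂ρ|)
    ∧ (∀ u ∈ Λ, Summable (fun n : ℕ => ‖term1 f finv Pm X n u‖)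
        ∧ Summable (fun n : ℕ => ‖term2 f finv Pp X n u‖))
    ∧ TendstoUniformlyOn (fun (N : ℕ) u => ∑ n ∈ Finset.range N, term1 f finv Pm X n u)
        (fun u => ∑' n : ℕ, term1 f finv Pm X n u) atTop Λ
    ∧ TendstoUniformlyOn (fun (N : ℕ) u => ∑ n ∈ Finset.range N, term2 f finv Pp X n u)
        (fun u => ∑' n : ℕ, term2 f finv Pp X n u) atTop Λ
    ∧ (∀ᵐ u₀ ∂ρ, Tendsto (fun K : ℕ => (1 / (K : ℝ)) * ∑ k ∈ Finset.range K,
          ⟪gradient J (f^[k] u₀),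
            (∑' n : ℕ, term1 f finv Pm X n (f^[k] u₀))
              - ∑' n : ℕ, term2 f finv Pp X n (f^[k] u₀)⟫_ℝ)
        atTop (nhds
          ((∑' n : ℕ, ∫ u, ⟪gradient (fun w => J (f^[n] w)) u, Pm u (X u)⟫_ℝ ∂ρ)
            - ∑' n : ℕ, ∫ u, ⟪gradient (fun w => J (finv^[n + 1] w)) u, Pp u (X u)⟫_ℝ ∂ρ))) := by
  have hfΛ : Set.MapsTo f Λ Λ := fun u hu ↦ hΛf ▸ Set.mem_image_of_mem f hu
  have hfinvΛ : Set.MapsTo finv Λ Λ := by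
    intro u hu
    rw [← hΛf] at hu
    obtain ⟨w, hw, rfl⟩ := hu
    rwa [hleft w]
  have hΛae : ∀ᵐ u ∂ρ, u ∈ Λ := (mem_ae_iff_prob_eq_one hΛc.measurableSet).2 hΛρ
  have hfρ := herg.toMeasurePreserving
  have hfinvρ : MeasurePreserving finv ρ ρ :=
    measurePreserving_of_inverse hfρ hfiC.continuous.measurable hleft
  obtain ⟨B, hB⟩ := hΛc.exists_bound_of_continuousOn hX.continuousOn
  have hgeom : Summable fun n : ℕ ↦ C₁ * lam ^ n * B :=
    ((summable_geometric_of_lt_one hlam0.le hlam1).mul_left C₁).mul_right B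
  have hgeom' : Summable fun n : ℕ ↦ C₁ * lam ^ (n + 1) * B :=
    (summable_nat_add_iff 1).2 hgeom
  have hXle (n : ℕ) {u} (hu : u ∈ Λ) : C₁ * lam ^ n * ‖X u‖ ≤ C₁ * lam ^ n * B :=
    mul_le_mul_of_nonneg_left (hB u hu) (by positivity)
  have hb1 : ∀ n, ∀ u ∈ Λ, ‖term1 f finv Pm X n u‖ ≤ C₁ * lam ^ n * B := fun n u hu ↦
    (hstab _ (hfinvΛ.iterate n hu) n _).trans (hXle n (hfinvΛ.iterate n hu))
  have hb2 : ∀ n, ∀ u ∈ Λ, ‖term2 f finv Pp X n u‖ ≤ C₁ * lam ^ (n + 1) * B := fun n u hu ↦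
    (hunstab _ (hfΛ.iterate (n + 1) hu) (n + 1) _).trans (hXle _ (hfΛ.iterate (n + 1) hu))
  have hc1 (n : ℕ) : ContinuousOn (term1 f finv Pm X n) Λ :=
    continuousOn_pushforward (contDiff_iterate hfC n) (hfiC.continuous.iterate n) hX hPmc
      (hfinvΛ.iterate n)
  have hc2 (n : ℕ) : ContinuousOn (term2 f finv Pp X n) Λ :=
    continuousOn_pushforward (contDiff_iterate hfiC (n + 1)) (hfC.continuous.iterate (n + 1)) hX hPpc
      (hfΛ.iterate (n + 1))
  have hi1 (n : ℕ) : ∫ u, ⟪gradient (fun w => J (f^[n] w)) u, Pm u (X u)⟫_ℝ ∂ρ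
      = ∫ u, ⟪gradient J u, term1 f finv Pm X n u⟫_ℝ ∂ρ :=
    integral_inner_gradient_comp hJ (contDiff_iterate hfC n) (hfiC.continuous.iterate n)
      (hleft.iterate n) (hright.iterate n) (hfρ.iterate n) fun u ↦ Pm u (X u)
  have hi2 (n : ℕ) : ∫ u, ⟪gradient (fun w => J (finv^[n + 1] w)) u, Pp u (X u)⟫_ℝ ∂ρ
      = ∫ u, ⟪gradient J u, term2 f finv Pp X n u⟫_ℝ ∂ρ :=
    integral_inner_gradient_comp hJ (contDiff_iterate hfiC (n + 1)) (hfC.continuous.iterate (n + 1))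
      (hright.leftInverse.iterate (n + 1)) (hleft.rightInverse.iterate (n + 1))
      (hfinvρ.iterate (n + 1)) fun u ↦ Pp u (X u)
  have hgrad := continuous_gradient_of_contDiff hJ
  obtain ⟨hs1, hint1, heq1⟩ :=
    tsum_integral_inner_of_norm_le hΛc hΛae hgrad hc1 hgeom hb1
  obtain ⟨hs2, hint2, heq2⟩ :=
    tsum_integral_inner_of_norm_le hΛc hΛae hgrad hc2 hgeom' hb2
  simp only [hi1, hi2]
  refine ⟨hs1, hs2, fun u hu ↦ ⟨?_, ?_⟩, tendstoUniformlyOn_tsum_nat hgeom hb1,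
    tendstoUniformlyOn_tsum_nat hgeom' hb2, ?_⟩
  · exact .of_nonneg_of_le (fun n ↦ norm_nonneg _) (fun n ↦ hb1 n u hu) hgeom
  · exact .of_nonneg_of_le (fun n ↦ norm_nonneg _) (fun n ↦ hb2 n u hu) hgeom'
  · rw [heq1, heq2, ← integral_sub hint1 hint2]
    filter_upwards [herg.ae_tendsto_birkhoffAverage (hint1.sub hint2)] with u hu
    simpa only [birkhoffAverage, birkhoffSum, Pi.sub_apply, smul_eq_mul, one_div, inner_sub_right]
      using hu
end

section
/- Let P : ℝ^M → ℝ^M be a linear projection (P ∘ P = P) of rank m ≥ 1, let α ∈ (0, π/2], and assume the angle between the range and the kernel of P is at least α, i.e. |⟨x, y⟩| ≤ cos(α)·‖x‖·‖y‖ for all x ∈ range(P) and y ∈ ker(P). Let B : ℝ^M → ℝ^M be linear with ‖Bx‖ ≤ c‖x‖ for all x ∈ range(P), where c ≥ 0. Then the squared Frobenius norm of the matrix of B∘P satisfies Σ_{i,j=1}^{M} (BP)_{ij}² ≤ c² m / sin²(α). In particular (B = id, c = 1), Σ_{i,j} P_{ij}² ≤ m / sin²(α). -/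
open scoped InnerProductSpace

section

variable {E F : Type*} [NormedAddCommGroup E] [InnerProductSpace ℝ E]
  [NormedAddCommGroup F] [InnerProductSpace ℝ F]

/-- An idempotent linear map whose range and kernel make an angle at least `α` is bounded
by `1 / sin α`. -/
lemma sin_mul_norm_apply_le_of_angle (P : E →ₗ[ℝ] E) (hproj : P ∘ₗ P = P) (α : ℝ)
    (hangle : ∀ x ∈ LinearMap.range P, ∀ y ∈ LinearMap.ker P,
      |⟪x, y⟫_ℝ| ≤ Real.cos α * ‖x‖ * ‖y‖) (x : E) :
    Real.sin α * ‖P x‖ ≤ ‖x‖ := by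
  have hk : x - P x ∈ LinearMap.ker P := by
    have h : P (P x) = P x := LinearMap.congr_fun hproj x
    simp [LinearMap.mem_ker, h]
  have h := (abs_le.1 (hangle (P x) ⟨x, rfl⟩ _ hk)).1
  have hx := norm_add_sq_real (P x) (x - P x)
  rw [add_sub_cancel] at hx
  refine le_of_abs_le (abs_le_of_sq_le_sq ?_ (norm_nonneg x))
  nlinarith [Real.sin_sq_add_cos_sq α, sq_nonneg (‖x - P x‖ - Real.cos α * ‖P x‖)]

variable [FiniteDimensional ℝ E] [FiniteDimensional ℝ F]

/-- The squared Frobenius norm of `T` is at most its rank times the square of any bound for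
its operator norm. -/
lemma sum_sq_norm_apply_le_finrank_range_mul {ι : Type*} [Fintype ι]
    (e : OrthonormalBasis ι ℝ E) (T : E →ₗ[ℝ] F) {K : ℝ} (hT : ∀ x, ‖T x‖ ≤ K * ‖x‖) :
    ∑ j, ‖T (e j)‖ ^ 2 ≤ Module.finrank ℝ (LinearMap.range T) * K ^ 2 := by
  let b := stdOrthonormalBasis ℝ (LinearMap.range T)
  have hadj (k) : ‖LinearMap.adjoint T (b k : F)‖ ^ 2 ≤ K ^ 2 := by
    set y := LinearMap.adjoint T (b k : F)
    have hb : ‖(b k : F)‖ = 1 := b.orthonormal.1 k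
    have h1 : ‖y‖ ^ 2 ≤ K * ‖y‖ := by
      calc ‖y‖ ^ 2 = ⟪(b k : F), T y⟫_ℝ := by
            rw [← LinearMap.adjoint_inner_left, real_inner_self_eq_norm_sq]
        _ ≤ ‖(b k : F)‖ * ‖T y‖ := real_inner_le_norm _ _
        _ ≤ K * ‖y‖ := by rw [hb, one_mul]; exact hT y
    nlinarith [sq_nonneg (K - ‖y‖)]
  have hexp (j) : ‖T (e j)‖ ^ 2 = ∑ k, ⟪LinearMap.adjoint T (b k : F), e j⟫_ℝ ^ 2 := by
    have h := b.sum_sq_norm_inner_right (LinearMap.rangeRestrict T (e j))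
    simp only [Real.norm_eq_abs, sq_abs, Submodule.coe_inner, Submodule.coe_norm,
      LinearMap.codRestrict_apply, LinearMap.rangeRestrict] at h
    simp only [LinearMap.adjoint_inner_left, h]
  calc ∑ j, ‖T (e j)‖ ^ 2
      = ∑ k, ‖LinearMap.adjoint T (b k : F)‖ ^ 2 := by
        simp only [hexp]
        rw [Finset.sum_comm]
        refine Finset.sum_congr rfl fun k _ => ?_
        simpa using e.sum_sq_norm_inner_left (LinearMap.adjoint T (b k : F))
    _ ≤ ∑ _k, K ^ 2 := Finset.sum_le_sum fun k _ => hadj k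
    _ = _ := by simp

end



/-- If `P` is a linear projection of rank `m ≥ 1` on `ℝ^M` whose range
and kernel make an angle at least `α ∈ (0, π/2]`, and `B` is linear with `‖Bx‖ ≤ c‖x‖`
on `range P`, then the squared Frobenius norm of `B∘P` is at most `c² m / sin²α`;
in particular the squared Frobenius norm of `P` is at most `m / sin²α`. -/
theorem stmt5 (M m : ℕ) (hM : 0 < M) (hm : 1 ≤ m)
    (P B : EuclideanSpace ℝ (Fin M) →ₗ[ℝ] EuclideanSpace ℝ (Fin M))
    (hproj : P ∘ₗ P = P)
    (hrank : Module.finrank ℝ (LinearMap.range P) = m)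
    (α : ℝ) (hα0 : 0 < α) (hα1 : α ≤ Real.pi / 2)
    (hangle : ∀ x ∈ LinearMap.range P, ∀ y ∈ LinearMap.ker P,
      |⟪x, y⟫_ℝ| ≤ Real.cos α * ‖x‖ * ‖y‖)
    (c : ℝ) (hc : 0 ≤ c)
    (hB : ∀ x ∈ LinearMap.range P, ‖B x‖ ≤ c * ‖x‖) :
    (∑ i : Fin M, ∑ j : Fin M,
        ⟪EuclideanSpace.single i (1 : ℝ), B (P (EuclideanSpace.single j 1))⟫_ℝ ^ 2
      ≤ c ^ 2 * m / Real.sin α ^ 2)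
    ∧ (∑ i : Fin M, ∑ j : Fin M,
        ⟪EuclideanSpace.single i (1 : ℝ), P (EuclideanSpace.single j 1)⟫_ℝ ^ 2
      ≤ m / Real.sin α ^ 2) := by
  have hsin : 0 < Real.sin α := Real.sin_pos_of_pos_of_lt_pi hα0 (by linarith [Real.pi_pos])
  have hP : ∑ j : Fin M, ‖P (EuclideanSpace.single j (1 : ℝ))‖ ^ 2 ≤ m / Real.sin α ^ 2 := by
    have h := sum_sq_norm_apply_le_finrank_range_mul (EuclideanSpace.basisFun (Fin M) ℝ) P
      (K := (Real.sin α)⁻¹) fun x => by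
        rw [inv_mul_eq_div, le_div_iff₀' hsin]
        exact sin_mul_norm_apply_le_of_angle P hproj α hangle x
    simpa [hrank, div_eq_mul_inv] using h
  have hfrob (T : EuclideanSpace ℝ (Fin M) →ₗ[ℝ] EuclideanSpace ℝ (Fin M)) :
      ∑ i : Fin M, ∑ j : Fin M,
        ⟪EuclideanSpace.single i (1 : ℝ), T (EuclideanSpace.single j 1)⟫_ℝ ^ 2
      = ∑ j : Fin M, ‖T (EuclideanSpace.single j (1 : ℝ))‖ ^ 2 := by
    rw [Finset.sum_comm]
    refine Finset.sum_congr rfl fun j _ => ?_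
    simp [EuclideanSpace.norm_sq_eq, EuclideanSpace.inner_single_left]
  refine ⟨?_, (hfrob P).trans_le hP⟩
  calc _ = ∑ j : Fin M, ‖B (P (EuclideanSpace.single j (1 : ℝ)))‖ ^ 2 := hfrob (B ∘ₗ P)
    _ ≤ ∑ j : Fin M, c ^ 2 * ‖P (EuclideanSpace.single j (1 : ℝ))‖ ^ 2 := by
        refine Finset.sum_le_sum fun j _ => ?_
        rw [← mul_pow]
        exact pow_le_pow_left₀ (norm_nonneg _) (hB _ ⟨_, rfl⟩) 2
    _ ≤ c ^ 2 * (m / Real.sin α ^ 2) := by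
        rw [← Finset.mul_sum]
        exact mul_le_mul_of_nonneg_left hP (sq_nonneg c)
    _ = c ^ 2 * m / Real.sin α ^ 2 := (mul_div_assoc _ _ _).symm
end

section
/- Let K ≥ 1 be an integer, λ ∈ (0,1), and let e_0, …, e_{K−1} and p_0, …, p_{K−1} be vectors in ℝ^M. Assume ‖e_k‖ ≤ λ^{K−1−k} ‖e_{K−1}‖ for all 0 ≤ k ≤ K−1, and that Σ_{k=0}^{K−1} ⟨e_k, e_k⟩ = Σ_{k=0}^{K−1} ⟨e_k, p_k⟩. Then ‖e_{K−1}‖ ≤ Σ_{k=0}^{K−1} λ^{K−1−k} ‖p_k‖. -/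
open scoped BigOperators InnerProductSpace

/-- If `‖e k‖ ≤ λ^(K−1−k) ‖e (K−1)‖` for `0 ≤ k ≤ K−1` and
`Σ_{k<K} ⟨e k, e k⟩ = Σ_{k<K} ⟨e k, p k⟩`, then
`‖e (K−1)‖ ≤ Σ_{k<K} λ^(K−1−k) ‖p k‖`. -/
theorem stmt9 (M K : ℕ) (hM : 0 < M) (hK : 1 ≤ K) (lam : ℝ)
    (hlam0 : 0 < lam) (hlam1 : lam < 1)
    (e p : ℕ → EuclideanSpace ℝ (Fin M))
    (hdecay : ∀ k, k ≤ K - 1 → ‖e k‖ ≤ lam ^ (K - 1 - k) * ‖e (K - 1)‖)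
    (heq : ∑ k ∈ Finset.range K, ⟪e k, e k⟫_ℝ = ∑ k ∈ Finset.range K, ⟪e k, p k⟫_ℝ) :
    ‖e (K - 1)‖ ≤ ∑ k ∈ Finset.range K, lam ^ (K - 1 - k) * ‖p k‖ := by
  have hsq : ‖e (K - 1)‖ * ‖e (K - 1)‖ ≤
      ‖e (K - 1)‖ * ∑ k ∈ Finset.range K, lam ^ (K - 1 - k) * ‖p k‖ := by
    calc ‖e (K - 1)‖ * ‖e (K - 1)‖ = ⟪e (K - 1), e (K - 1)⟫_ℝ :=
          (real_inner_self_eq_norm_mul_norm _).symm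
      _ ≤ ∑ k ∈ Finset.range K, ⟪e k, e k⟫_ℝ :=
          Finset.single_le_sum (f := fun k => ⟪e k, e k⟫_ℝ)
            (fun k _ => real_inner_self_nonneg) (Finset.mem_range.2 (by omega))
      _ = ∑ k ∈ Finset.range K, ⟪e k, p k⟫_ℝ := heq
      _ ≤ ∑ k ∈ Finset.range K, ‖e (K - 1)‖ * (lam ^ (K - 1 - k) * ‖p k‖) := by
          refine Finset.sum_le_sum fun k hk => (real_inner_le_norm _ _).trans ?_
          have hk' : k ≤ K - 1 := by have := Finset.mem_range.1 hk; omega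
          calc ‖e k‖ * ‖p k‖ ≤ lam ^ (K - 1 - k) * ‖e (K - 1)‖ * ‖p k‖ :=
                mul_le_mul_of_nonneg_right (hdecay k hk') (norm_nonneg _)
            _ = ‖e (K - 1)‖ * (lam ^ (K - 1 - k) * ‖p k‖) := by ring
      _ = _ := (Finset.mul_sum _ _ _).symm
  rcases (norm_nonneg (e (K - 1))).eq_or_lt with h | h
  · exact h.symm.le.trans (Finset.sum_nonneg fun k _ =>
      mul_nonneg (pow_nonneg hlam0.le _) (norm_nonneg _))
  · exact le_of_mul_le_mul_left hsq h
end
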